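/- The subgroup Aut(G; [y₁], [y₂]) of Aut(G) consisting of all automorphisms φ with φ(y₁) conjugate to y₁ in G and φ(y₂) conjugate to y₂ in G is generated by the automorphisms P_{i,j}, I_i, (c_i^{±1}; z) for z ∈ {y₁, y₂} ∪ {c_j : j ≠ i}, and (y_i^±; z) for i ∈ {1,2} and z ∈ {y₁, y₂, c₁, …, c_{n−2}} \ {y_i}. -/

import Mathlib

/-! The free group `G m` of rank `m + 2` has basis `{y₁, y₂, c₁, …, c_m}` where
`y₁ = of 0`, `y₂ = of 1` and `cᵢ = of (i + 1)` (i.e. the basis elements of index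
`≥ 2` are the `cᵢ`). -/

abbrev G (m : ℕ) := FreeGroup (Fin (m + 2))

/-- `P_{i,j}`: interchanges `cᵢ` and `c_j`, fixes all other basis elements. -/
def IsP {m : ℕ} (φ : MulAut (G m)) : Prop :=
  ∃ i j : Fin (m + 2), 2 ≤ (i : ℕ) ∧ 2 ≤ (j : ℕ) ∧ i ≠ j ∧
    φ (FreeGroup.of i) = FreeGroup.of j ∧ φ (FreeGroup.of j) = FreeGroup.of i ∧
    ∀ k, k ≠ i → k ≠ j → φ (FreeGroup.of k) = FreeGroup.of k

/-- `I_i`: sends `cᵢ` to `cᵢ⁻¹`, fixes all other basis elements. -/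
def IsI {m : ℕ} (φ : MulAut (G m)) : Prop :=
  ∃ i : Fin (m + 2), 2 ≤ (i : ℕ) ∧ φ (FreeGroup.of i) = (FreeGroup.of i)⁻¹ ∧
    ∀ k, k ≠ i → φ (FreeGroup.of k) = FreeGroup.of k

/-- the allowed twisting elements for `(cᵢ^{±1}; z)` : `z ∈ {y₁, y₂} ∪ {c_j : j ≠ i}`. -/
def ZSet (m : ℕ) (i : Fin (m + 2)) : Set (G m) :=
  {FreeGroup.of 0, FreeGroup.of 1} ∪
    {x | ∃ j : Fin (m + 2), 2 ≤ (j : ℕ) ∧ j ≠ i ∧ x = FreeGroup.of j}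

/-- `(cᵢ; z) : cᵢ ↦ cᵢ z` and `(cᵢ⁻¹; z) : cᵢ ↦ z⁻¹ cᵢ`, fixing all other basis
elements, for `z ∈ {y₁, y₂} ∪ {c_j : j ≠ i}`. -/
def IsTransC {m : ℕ} (φ : MulAut (G m)) : Prop :=
  ∃ i : Fin (m + 2), 2 ≤ (i : ℕ) ∧ ∃ z ∈ ZSet m i,
    (φ (FreeGroup.of i) = FreeGroup.of i * z ∨
      φ (FreeGroup.of i) = z⁻¹ * FreeGroup.of i) ∧
    ∀ k, k ≠ i → φ (FreeGroup.of k) = FreeGroup.of k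

/-- `(yᵢ^±; z) : yᵢ ↦ z⁻¹ yᵢ z`, fixing all other basis elements, for `i ∈ {1, 2}`
and `z` a basis element distinct from `yᵢ` (i.e. `z ∈ {y₁, y₂, c₁, …, c_m} \ {yᵢ}`). -/
def IsConjY {m : ℕ} (φ : MulAut (G m)) : Prop :=
  ∃ i : Fin (m + 2), (i : ℕ) < 2 ∧
    ∃ z ∈ {x | ∃ j : Fin (m + 2), j ≠ i ∧ x = FreeGroup.of j},
      φ (FreeGroup.of i) = z⁻¹ * FreeGroup.of i * z ∧
      ∀ k, k ≠ i → φ (FreeGroup.of k) = FreeGroup.of k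

namespace List

variable {β : Type*} [DecidableEq β]

/-- The length of the longest common prefix of two lists. -/
def commonPrefixLength : List β → List β → ℕ
  | a :: l, b :: l' => if a = b then commonPrefixLength l l' + 1 else 0
  | _, _ => 0

theorem exists_commonPrefix (l l' : List β) :
    ∃ p s t, l = p ++ s ∧ l' = p ++ t ∧ p.length = commonPrefixLength l l' ∧
      ∀ x ∈ s.head?, x ∉ t.head? := by
  induction l generalizing l' with
  | nil => exact ⟨[], [], l', by simp [commonPrefixLength]⟩
  | cons a l ih =>
    cases l' with
    | nil => exact ⟨[], a :: l, [], by simp [commonPrefixLength]⟩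
    | cons b l' =>
      by_cases h : a = b
      · obtain ⟨p, s, t, h1, h2, h3, h4⟩ := ih l'
        exact ⟨b :: p, s, t, by simp [h, h1], by simp [h2],
          by simp [commonPrefixLength, h, h3], h4⟩
      · exact ⟨[], a :: l, b :: l', rfl, rfl, by simp [commonPrefixLength, h],
          by simpa using fun h' => h h'.symm⟩

theorem commonPrefixLength_comm (l l' : List β) :
    commonPrefixLength l l' = commonPrefixLength l' l := by
  induction l generalizing l' with
  | nil => cases l' <;> rfl
  | cons a l ih => cases l' <;> grind [commonPrefixLength]

theorem le_commonPrefixLength_iff {l l' : List β} {k : ℕ} :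
    k ≤ commonPrefixLength l l' ↔ k ≤ l.length ∧ k ≤ l'.length ∧ l.take k = l'.take k := by
  induction l generalizing l' k with
  | nil => cases l' <;> cases k <;> simp [commonPrefixLength]
  | cons a l ih => cases l' <;> cases k <;> grind [commonPrefixLength]

theorem commonPrefixLength_eq_of_lt {l₁ l₂ l₃ : List β}
    (h : commonPrefixLength l₁ l₂ < commonPrefixLength l₂ l₃) :
    commonPrefixLength l₁ l₃ = commonPrefixLength l₁ l₂ := by
  induction l₂ generalizing l₁ l₃ with
  | nil => simp [commonPrefixLength] at h
  | cons a l ih => cases l₁ <;> cases l₃ <;> grind [commonPrefixLength]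

theorem min_commonPrefixLength_le (l₁ l₂ l₃ : List β) :
    min (commonPrefixLength l₁ l₂) (commonPrefixLength l₂ l₃) ≤ commonPrefixLength l₁ l₃ := by
  induction l₂ generalizing l₁ l₃ with
  | nil => cases l₁ <;> simp [commonPrefixLength]
  | cons a l ih => cases l₁ <;> cases l₃ <;> grind [commonPrefixLength]

end List

namespace FreeGroup

variable {α : Type*}

theorem mk_singleton_not (a : α × Bool) : mk [(a.1, !a.2)] = (mk [a])⁻¹ := by
  simp [inv_mk, invRev]

theorem isReduced_singleton (a : α × Bool) : IsReduced [a] := List.isChain_singleton a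

theorem mk_singleton_eq_or (i : α) (a : α × Bool) (h : a.1 = i) :
    mk [a] = of i ∨ mk [a] = (of i)⁻¹ := by
  obtain ⟨j, _ | _⟩ := a <;> subst h <;> simp [of, inv_mk, invRev]

theorem mk_conj_letter (L : List (α × Bool)) (a : α × Bool) :
    mk (L ++ a :: invRev L) = mk L * mk [a] * (mk L)⁻¹ := by
  simp [inv_mk]

theorem mulAut_ext {φ ψ : MulAut (FreeGroup α)} (h : ∀ i, φ (of i) = ψ (of i)) : φ = ψ :=
  MulEquiv.toMonoidHom_injective (ext_hom _ _ h)

/-- A numbering of words which is lexicographic on the words of each given length. -/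
noncomputable def wordRank [Fintype α] (L : List (α × Bool)) : ℕ :=
  Nat.ofDigits (Fintype.card (α × Bool) + 2)
    (L.reverse.map fun a => (Fintype.equivFin (α × Bool) a : ℕ))

theorem wordRank_append_lt [Fintype α] {p q : List (α × Bool)} (h : wordRank q < wordRank p)
    (t : List (α × Bool)) : wordRank (q ++ t) < wordRank (p ++ t) := by
  simp only [wordRank, List.reverse_append, List.map_append, Nat.ofDigits_append] at *
  gcongr

theorem wordRank_inj [Fintype α] {p q : List (α × Bool)} (hlen : p.length = q.length)
    (h : wordRank p = wordRank q) : p = q := by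
  have := Nat.ofDigits_inj_of_len_eq (by lia) (by simpa using hlen)
    (fun l hl => ?_) (fun l hl => ?_) h
  · rw [List.map_inj_right, List.reverse_inj] at this
    · exact this
    · intro a b hab
      exact (Fintype.equivFin _).injective (Fin.ext hab)
  all_goals
    obtain ⟨a, -, rfl⟩ := List.mem_map.1 hl
    lia

variable [DecidableEq α]

/-- The Gromov product of two elements of a free group: the length of the longest common prefix
of their reduced words. -/
def gromovProduct (g h : FreeGroup α) : ℕ := g.toWord.commonPrefixLength h.toWord

theorem gromovProduct_comm (g h : FreeGroup α) : gromovProduct g h = gromovProduct h g :=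
  List.commonPrefixLength_comm _ _

theorem gromovProduct_le_left (g h : FreeGroup α) : gromovProduct g h ≤ g.norm :=
  (List.le_commonPrefixLength_iff.1 le_rfl).1

theorem gromovProduct_le_right (g h : FreeGroup α) : gromovProduct g h ≤ h.norm :=
  (List.le_commonPrefixLength_iff.1 le_rfl).2.1

theorem gromovProduct_one_right (g : FreeGroup α) : gromovProduct g 1 = 0 := by
  simpa using gromovProduct_le_right g 1

theorem gromovProduct_eq_of_lt {g h k : FreeGroup α}
    (hlt : gromovProduct g h < gromovProduct h k) : gromovProduct g k = gromovProduct g h :=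
  List.commonPrefixLength_eq_of_lt hlt

theorem exists_toWord_inv_mul (g h : FreeGroup α) :
    ∃ p s t, g.toWord = p ++ s ∧ h.toWord = p ++ t ∧ p.length = gromovProduct g h ∧
      (g⁻¹ * h).toWord = invRev s ++ t := by
  obtain ⟨p, s, t, h1, h2, h3, h4⟩ := List.exists_commonPrefix g.toWord h.toWord
  refine ⟨p, s, t, h1, h2, h3, ?_⟩
  have hs : IsReduced (invRev s) := by
    have : IsReduced (p ++ s) := h1 ▸ isReduced_toWord
    have : IsReduced s := this.infix ⟨p, [], by simp⟩
    rw [isReduced_iff_reduce_eq] at this ⊢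
    rw [reduce_invRev, this]
  have ht : IsReduced t := (h2 ▸ isReduced_toWord : IsReduced (p ++ t)).infix ⟨p, [], by simp⟩
  have hst : IsReduced (invRev s ++ t) := by
    unfold IsReduced at *
    rw [List.isChain_append]
    refine ⟨hs, ht, ?_⟩
    intro x hx y hy hxy
    cases s with
    | nil => simp at hx
    | cons a s =>
      simp [invRev] at hx
      have := h4 a (by simp)
      subst hx
      by_contra hne
      apply this
      have : y = a := Prod.ext hxy.symm (by cases h : a.2 <;> cases h' : y.2 <;> simp_all)
      rwa [← this]
  rw [← hst.reduce_eq, ← mk_toWord (x := g), ← mk_toWord (x := h), h1, h2, ← toWord_mk]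
  simp [← mul_mk, ← inv_mk, mul_assoc]

theorem norm_inv_mul_add (g h : FreeGroup α) :
    (g⁻¹ * h).norm + 2 * gromovProduct g h = g.norm + h.norm := by
  obtain ⟨p, s, t, h1, h2, h3, h4⟩ := exists_toWord_inv_mul g h
  simp only [norm, h1, h2, h4, ← h3, List.length_append, invRev_length]
  ring

theorem gromovProduct_self_mul_add (g h : FreeGroup α) :
    gromovProduct g (g * h) + gromovProduct g⁻¹ h = g.norm := by
  have h1 := norm_inv_mul_add g (g * h)
  have h2 := norm_inv_mul_add g⁻¹ h
  simp only [inv_mul_cancel_left, inv_inv, norm_inv_eq] at h1 h2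
  lia

theorem two_mul_gromovProduct_inv_lt {g : FreeGroup α} (hg : g ≠ 1) :
    2 * gromovProduct g g⁻¹ < g.norm := by
  by_contra! hle
  have hpos : 0 < g.norm := Nat.pos_of_ne_zero (by simpa using hg)
  obtain ⟨-, -, hk⟩ := List.le_commonPrefixLength_iff.1 (le_refl (gromovProduct g g⁻¹))
  have key : ∀ i < gromovProduct g g⁻¹, ∀ (h : i < g.toWord.length), g.toWord[i] =
      ((g.toWord[g.toWord.length - 1 - i]).1, !(g.toWord[g.toWord.length - 1 - i]).2) := by
    intro i hi h
    have : g.toWord[i]? = (g⁻¹).toWord[i]? := by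
      rw [← List.getElem?_take_of_lt hi, hk, List.getElem?_take_of_lt hi]
    rw [List.getElem?_eq_getElem h, toWord_inv, List.getElem?_eq_getElem (by simpa using h)] at this
    simpa [invRev] using this
  have hn : g.norm = g.toWord.length := rfl
  have hr : IsReduced g.toWord := isReduced_toWord
  rcases Nat.even_or_odd' g.norm with ⟨k, hk' | hk'⟩
  · have h1 := key (k - 1) (by lia) (by lia)
    have h2 := List.isChain_iff_getElem.1 hr (k - 1) (by lia)
    have e1 : g.toWord.length - 1 - (k - 1) = k - 1 + 1 := by lia
    simp only [e1] at h1
    rw [h1] at h2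
    simp at h2
  · have h1 := key k (by lia) (by lia)
    have e1 : g.toWord.length - 1 - k = k := by lia
    simp only [e1] at h1
    have := congrArg Prod.snd h1
    simp at this

/-- An endomorphism of a free group is Nielsen reduced if, in the image of any letter `a`, the
cancellations with the images of neighbouring letters leave at least one letter untouched. -/
def IsNielsenReduced (φ : FreeGroup α →* FreeGroup α) : Prop :=
  ∀ a b c : α × Bool, b ≠ a → c ≠ (a.1, !a.2) →
    gromovProduct (φ (mk [b])) (φ (mk [a])) + gromovProduct (φ (mk [c])) (φ (mk [a]))⁻¹ <
      (φ (mk [a])).norm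

theorem IsNielsenReduced.add_length_le_norm {φ : FreeGroup α →* FreeGroup α}
    (hφ : IsNielsenReduced φ) {L : List (α × Bool)} (hL : IsReduced L) :
    (∀ b ∉ L.head?, gromovProduct (φ (mk [b])) (φ (mk L)) + L.length ≤ (φ (mk L)).norm) ∧
      ∀ a ∈ L.head?, ∀ b ≠ a,
        gromovProduct (φ (mk [b])) (φ (mk L)) = gromovProduct (φ (mk [b])) (φ (mk [a])) := by
  induction L with
  | nil => simp [← one_eq_mk, gromovProduct_one_right]
  | cons a L ih =>
    obtain ⟨ih₁, ih₂⟩ := ih (hL.infix ⟨[a], [], by simp⟩)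
    have hhead : (a.1, !a.2) ∉ L.head? := by
      intro h
      cases L with
      | nil => simp at h
      | cons b L =>
        have := (List.isChain_cons_cons.1 hL).1
        simp only [List.head?_cons, Option.mem_some_iff] at h
        subst h
        simp at this
    have hmul : φ (mk (a :: L)) = φ (mk [a]) * φ (mk L) := by
      rw [← _root_.map_mul, mul_mk, List.singleton_append]
    have hadd := gromovProduct_self_mul_add (φ (mk [a])) (φ (mk L))
    rw [← hmul] at hadd
    have hlt : ∀ b ≠ a, gromovProduct (φ (mk [b])) (φ (mk [a])) +
        gromovProduct (φ (mk [a]))⁻¹ (φ (mk L)) < (φ (mk [a])).norm := by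
      intro b hb
      cases L with
      | nil =>
        have := hφ a b a hb (by simp [Prod.ext_iff])
        rw [← one_eq_mk, _root_.map_one, gromovProduct_one_right]
        lia
      | cons c L =>
        have hc : c ≠ (a.1, !a.2) := by simpa using hhead
        have := ih₂ c (by simp) _ hc.symm
        rw [mk_singleton_not, _root_.map_inv] at this
        rw [this, gromovProduct_comm (φ (mk [a]))⁻¹]
        exact hφ a b c hb hc
    have heq : ∀ b ≠ a, gromovProduct (φ (mk [b])) (φ (mk (a :: L))) =
        gromovProduct (φ (mk [b])) (φ (mk [a])) := fun b hb =>
      gromovProduct_eq_of_lt (by have := hlt b hb; lia)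
    refine ⟨fun b hb => ?_, fun a' ha' b hb => ?_⟩
    · have hb : b ≠ a := fun h => hb (by simp [h])
      have h1 := hlt b hb
      have h2 := ih₁ _ hhead
      have h3 := norm_inv_mul_add (φ (mk [a]))⁻¹ (φ (mk L))
      rw [inv_inv, ← hmul, norm_inv_eq] at h3
      rw [mk_singleton_not, _root_.map_inv] at h2
      rw [heq b hb, List.length_cons]
      lia
    · obtain rfl : a = a' := by simpa using ha'
      exact heq b hb

theorem IsNielsenReduced.exists_letter {φ : FreeGroup α →* FreeGroup α}
    (hφ : IsNielsenReduced φ) (hsurj : Function.Surjective φ) (i : α) :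
    ∃ a : α × Bool, φ (mk [a]) = of i := by
  obtain ⟨g, hg⟩ := hsurj (of i)
  have hlen : g.toWord.length ≤ 1 := by
    have key := (hφ.add_length_le_norm (isReduced_toWord (x := g))).1
    rw [mk_toWord, hg, norm_of] at key
    cases hw : g.toWord with
    | nil => simp
    | cons a L =>
      have := key (a.1, !a.2) (by simp [hw, Prod.ext_iff])
      rw [hw] at this
      lia
  obtain ⟨a, ha⟩ : ∃ a, g.toWord = [a] := by
    rw [← List.length_eq_one_iff]
    have : g.toWord.length ≠ 0 := by
      intro h
      rw [List.length_eq_zero_iff, toWord_eq_nil_iff] at h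
      rw [h, _root_.map_one] at hg
      exact one_ne_of i hg
    lia
  exact ⟨a, by rw [← ha, mk_toWord, hg]⟩

theorem fst_eq_of_mk_singleton_eq_or {a b : α × Bool}
    (h : mk [a] = mk [b] ∨ mk [a] = (mk [b])⁻¹) : a.1 = b.1 := by
  rw [← mk_singleton_not] at h
  rcases h with h | h <;>
  · have := congrArg toWord h
    rw [toWord_mk, toWord_mk, (isReduced_singleton _).reduce_eq,
      (isReduced_singleton _).reduce_eq] at this
    simpa using congrArg (fun l => l.head?.map Prod.fst) this

theorem IsNielsenReduced.exists_perm [Finite α] {φ : FreeGroup α →* FreeGroup α}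
    (hφ : IsNielsenReduced φ) (hsurj : Function.Surjective φ) :
    ∃ (σ : Equiv.Perm α) (ε : α → Bool), ∀ i, φ (of i) = mk [(σ i, ε i)] := by
  choose f hf using hφ.exists_letter hsurj
  have hinj : Function.Injective fun i => (f i).1 := by
    intro i j hij
    refine fst_eq_of_mk_singleton_eq_or (a := (i, true)) (b := (j, true)) ?_
    change of i = of j ∨ of i = (of j)⁻¹
    rw [← hf i, ← hf j, ← _root_.map_inv]
    rcases mk_singleton_eq_or _ (f i) hij with h | h <;>
      rcases mk_singleton_eq_or _ (f j) rfl with h' | h' <;> simp [h, h']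
  let τ : Equiv.Perm α := Equiv.ofBijective _ (Finite.injective_iff_bijective.1 hinj)
  have hτ : ∀ i, ∃ ε, φ (of i) = mk [(τ.symm i, ε)] := by
    intro i
    obtain ⟨j, rfl⟩ := τ.surjective i
    rw [Equiv.symm_apply_apply]
    rcases mk_singleton_eq_or (τ j) (f j) rfl with h | h
    · exact ⟨true, by rw [← h, hf, of]⟩
    · refine ⟨false, ?_⟩
      rw [← inv_inv (of (τ j)), ← h, _root_.map_inv, hf]
      exact (mk_singleton_not (j, true)).symm
  choose ε hε using hτ
  exact ⟨τ.symm, ε, hε⟩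

theorem exists_toWord_conj_letter (g : FreeGroup α) (a : α × Bool) :
    ∃ u, (g * mk [a] * g⁻¹).toWord = u ++ a :: invRev u := by
  suffices ∀ L : List (α × Bool),
      ∃ u, (mk L * mk [a] * (mk L)⁻¹) = mk (u ++ a :: invRev u) ∧
        IsReduced (u ++ a :: invRev u) by
    obtain ⟨u, h1, h2⟩ := this g.toWord
    exact ⟨u, by rw [← mk_toWord (x := g), h1, toWord_mk, h2.reduce_eq]⟩
  intro L
  induction L with
  | nil => exact ⟨[], by simp [← one_eq_mk], isReduced_singleton a⟩
  | cons b L ih =>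
    obtain ⟨u, h1, h2⟩ := ih
    have hmul : mk (b :: L) * mk [a] * (mk (b :: L))⁻¹ =
        mk [b] * mk (u ++ a :: invRev u) * (mk [b])⁻¹ := by
      rw [← h1, ← List.singleton_append, ← mul_mk]
      group
    rw [hmul]
    cases u with
    | nil =>
      by_cases hba : b.1 = a.1
      · refine ⟨[], ?_, isReduced_singleton a⟩
        rcases mk_singleton_eq_or _ b hba with h | h <;>
          rcases mk_singleton_eq_or _ a rfl with h' | h' <;> simp [h, h', invRev]
      · refine ⟨[b], by simp [inv_mk, invRev], ?_⟩
        simp [IsReduced, invRev, hba, Ne.symm hba]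
    | cons c u =>
      by_cases hred : IsReduced (b :: (c :: u ++ a :: invRev (c :: u)))
      · refine ⟨b :: c :: u, by simp [inv_mk, invRev], ?_⟩
        simp only [IsReduced, List.isChain_append, List.isChain_cons] at *
        simp [invRev] at *
        grind
      · have hbc : b = (c.1, !c.2) := by
          rw [List.cons_append, IsReduced, List.isChain_cons_cons] at hred
          have : ¬ (b.1 = c.1 → b.2 = c.2) := fun h => hred ⟨h, h2⟩
          ext
          · tauto
          · cases hb : b.2 <;> cases hc : c.2 <;> simp_all
        refine ⟨u, ?_, h2.infix ⟨[c], [(c.1, !c.2)], by simp [invRev]⟩⟩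
        have hc : mk (c :: u ++ a :: invRev (c :: u)) =
            mk [c] * mk (u ++ a :: invRev u) * (mk [c])⁻¹ := by
          simp [inv_mk, invRev]
        rw [hbc, hc, mk_singleton_not]
        group

theorem norm_mk_conj_letter_le (L : List (α × Bool)) (a : α × Bool) :
    (mk (L ++ a :: invRev L)).norm ≤ 2 * L.length + 1 := by
  refine norm_mk_le.trans ?_
  simp only [List.length_append, List.length_cons, invRev_length]
  lia

theorem conj_mk_conj_letter (x : FreeGroup α) (u : List (α × Bool)) (a : α × Bool) :
    x⁻¹ * mk (u ++ a :: invRev u) * x =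
      mk ((x⁻¹ * mk u).toWord ++ a :: invRev (x⁻¹ * mk u).toWord) := by
  rw [mk_conj_letter, mk_conj_letter, mk_toWord]
  group

theorem toWord_mk_of_toWord_eq_append {g : FreeGroup α} {u v : List (α × Bool)}
    (h : g.toWord = u ++ v) : (mk u).toWord = u := by
  rw [toWord_mk]
  exact (((h ▸ isReduced_toWord : IsReduced (u ++ v))).infix ⟨[], v, by simp⟩).reduce_eq

theorem min_le_gromovProduct_mk {x y : FreeGroup α} {u v : List (α × Bool)}
    (h : y.toWord = u ++ v) :
    min (gromovProduct x y) u.length ≤ gromovProduct x (mk u) := by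
  refine le_trans ?_ (List.min_commonPrefixLength_le x.toWord y.toWord (mk u).toWord)
  refine min_le_min le_rfl (List.le_commonPrefixLength_iff.2 ?_)
  rw [toWord_mk_of_toWord_eq_append h, h]
  simp

theorem exists_toWord_of_isConj {φ : FreeGroup α →* FreeGroup α} {a : α × Bool}
    (h : IsConj (of a.1) (φ (of a.1))) : ∃ u, (φ (mk [a])).toWord = u ++ a :: invRev u := by
  obtain ⟨g, hg⟩ := isConj_iff.1 h
  convert exists_toWord_conj_letter g a using 3
  rcases mk_singleton_eq_or a.1 a rfl with h' | h' <;> rw [h']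
  · rw [hg]
  · rw [_root_.map_inv, ← hg]
    group

theorem exists_mulAut_of_eq_mul_mul (i : α) {g h : FreeGroup α}
    (hg : g ∈ Subgroup.closure (of '' {i}ᶜ)) (hh : h ∈ Subgroup.closure (of '' {i}ᶜ)) :
    ∃ ψ : MulAut (FreeGroup α),
      (ψ (of i) = g * of i * h ∧ ∀ k ≠ i, ψ (of k) = of k) ∧
      (ψ⁻¹ (of i) = g⁻¹ * of i * h⁻¹ ∧ ∀ k ≠ i, ψ⁻¹ (of k) = of k) := by
  let F (g h : FreeGroup α) : FreeGroup α →* FreeGroup α :=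
    lift (Function.update of i (g * of i * h))
  have hFi (g h) : F g h (of i) = g * of i * h := by simp [F]
  have hFk (g h) (k) (hk : k ≠ i) : F g h (of k) = of k := by simp [F, hk]
  have hfix (g h) {x} (hx : x ∈ Subgroup.closure (of '' {i}ᶜ)) : F g h x = x := by
    refine MonoidHom.eqOn_closure (f := F g h) (g := MonoidHom.id _) ?_ hx
    rintro _ ⟨k, hk, rfl⟩
    exact hFk g h k hk
  have hcomp : ∀ {g h}, g ∈ Subgroup.closure (of '' {i}ᶜ) → h ∈ Subgroup.closure (of '' {i}ᶜ) →
      (F g⁻¹ h⁻¹).comp (F g h) = MonoidHom.id _ := by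
    intro g h hg hh
    refine ext_hom _ _ fun k => ?_
    by_cases hk : k = i
    · subst hk
      simp only [MonoidHom.comp_apply, hFi, _root_.map_mul, hfix _ _ hg, hfix _ _ hh,
        MonoidHom.id_apply]
      group
    · simp only [MonoidHom.comp_apply, hFk _ _ k hk, MonoidHom.id_apply]
  refine ⟨MonoidHom.toMulEquiv (F g h) (F g⁻¹ h⁻¹) (hcomp hg hh) ?_,
    ⟨hFi g h, hFk g h⟩, hFi _ _, hFk _ _⟩
  simpa using hcomp (inv_mem hg) (inv_mem hh)

theorem exists_mulAut_of_eq_inv (i : α) :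
    ∃ ψ : MulAut (FreeGroup α), ψ (of i) = (of i)⁻¹ ∧ ∀ k ≠ i, ψ (of k) = of k := by
  let F : FreeGroup α →* FreeGroup α := lift (Function.update of i (of i)⁻¹)
  have hFi : F (of i) = (of i)⁻¹ := by simp [F]
  have hFk (k) (hk : k ≠ i) : F (of k) = of k := by simp [F, hk]
  have hcomp : F.comp F = MonoidHom.id _ := by
    refine ext_hom _ _ fun k => ?_
    by_cases hk : k = i
    · simp only [hk, MonoidHom.comp_apply, hFi, _root_.map_inv, inv_inv, MonoidHom.id_apply]
    · simp only [MonoidHom.comp_apply, hFk k hk, MonoidHom.id_apply]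
  exact ⟨MonoidHom.toMulEquiv F F hcomp hcomp, hFi, hFk⟩

variable [Fintype α]

/-- The rank of the first half of the reduced word of `g`. -/
noncomputable def halfRank (g : FreeGroup α) : ℕ := wordRank (g.toWord.take (g.norm / 2))

/-- The length of `g`, refined by the lexicographic positions of the halves of `g` and `g⁻¹`. -/
noncomputable def complexity (g : FreeGroup α) : ℕ ×ₗ ℕ :=
  toLex (g.norm, halfRank g + halfRank g⁻¹)

theorem complexity_inv (g : FreeGroup α) : complexity g⁻¹ = complexity g := by
  simp [complexity, add_comm]

theorem complexity_lt_of_norm_lt {g h : FreeGroup α} (hlt : g.norm < h.norm) :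
    complexity g < complexity h :=
  Prod.Lex.toLex_lt_toLex.2 (Or.inl hlt)

theorem complexity_lt_of_halfRank_lt {g h : FreeGroup α} (hnorm : g.norm = h.norm)
    (hlt : halfRank g + halfRank g⁻¹ < halfRank h + halfRank h⁻¹) :
    complexity g < complexity h :=
  Prod.Lex.toLex_lt_toLex.2 (Or.inr ⟨hnorm, hlt⟩)

theorem complexity_inv_mul_lt {x y : FreeGroup α} (h : x.norm < 2 * gromovProduct x y) :
    complexity (x⁻¹ * y) < complexity y :=
  complexity_lt_of_norm_lt (by have := norm_inv_mul_add x y; lia)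

theorem complexity_inv_mul_lt_of_wordRank_lt {x y : FreeGroup α}
    (hx : x.norm = 2 * gromovProduct x y) (hy : 2 * gromovProduct x y ≤ y.norm)
    (hlt : wordRank (x⁻¹.toWord.take (gromovProduct x y)) <
      wordRank (x.toWord.take (gromovProduct x y))) :
    complexity (x⁻¹ * y) < complexity y := by
  have hnorm := norm_inv_mul_add x y
  obtain ⟨p, s, t, h1, h2, h3, h4⟩ := exists_toWord_inv_mul x y
  have hs : s.length = p.length := by
    simp only [norm, h1, ← h3, List.length_append] at hx
    lia
  have ht : y.norm = p.length + t.length := by simp [norm, h2]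
  have h5 : wordRank (invRev s) < wordRank p := by
    simpa [h1, ← h3, ← hs, List.take_append] using hlt
  refine complexity_lt_of_halfRank_lt (by lia) ?_
  have h6 : (x⁻¹ * y).norm = y.norm := by lia
  simp only [halfRank, norm_inv_eq, h6]
  simp only [toWord_inv, h4, h2, invRev_append, invRev_invRev]
  rw [List.take_append_of_le_length (l₁ := invRev t) (by rw [invRev_length]; lia),
    List.take_append_of_le_length (l₁ := invRev t) (by rw [invRev_length]; lia),
    List.take_append, List.take_append, List.take_of_length_le (by rw [invRev_length]; lia),
    List.take_of_length_le (l := p) (by lia), invRev_length, hs]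
  exact Nat.add_lt_add_right (wordRank_append_lt h5 _) _

theorem complexity_conj_lt {x y : FreeGroup α} {u : List (α × Bool)} {a : α × Bool}
    (hy : y.toWord = u ++ a :: invRev u) (h : x.norm < 2 * gromovProduct x y)
    (h' : x.norm < 2 * u.length) :
    complexity (x⁻¹ * y * x) < complexity y := by
  refine complexity_lt_of_norm_lt ?_
  have h1 := norm_inv_mul_add x (mk u)
  have h2 := min_le_gromovProduct_mk (x := x) hy
  have h3 : (mk u).norm = u.length := by rw [norm, toWord_mk_of_toWord_eq_append hy]
  have h4 : y.norm = 2 * u.length + 1 := by simp [norm, hy]; lia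
  have h5 := norm_mk_conj_letter_le (x⁻¹ * mk u).toWord a
  rw [← conj_mk_conj_letter, ← hy, mk_toWord] at h5
  have : (x⁻¹ * mk u).toWord.length = (x⁻¹ * mk u).norm := rfl
  lia

theorem complexity_conj_lt_of_wordRank_lt {x y : FreeGroup α} {u : List (α × Bool)} {a : α × Bool}
    (hyu : y.toWord = u ++ a :: invRev u)
    (hx : x.norm = 2 * gromovProduct x y) (hy : 2 * gromovProduct x y ≤ y.norm)
    (hlt : wordRank (x⁻¹.toWord.take (gromovProduct x y)) <
      wordRank (x.toWord.take (gromovProduct x y))) :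
    complexity (x⁻¹ * y * x) < complexity y := by
  have hynorm : y.norm = 2 * u.length + 1 := by simp [norm, hyu]; lia
  obtain ⟨p, s, t, h1, h2, h3, h4⟩ := exists_toWord_inv_mul x y
  have hs : s.length = p.length := by
    simp only [norm, h1, ← h3, List.length_append] at hx
    lia
  have h5 : wordRank (invRev s) < wordRank p := by
    simpa [h1, ← h3, ← hs, List.take_append] using hlt
  obtain ⟨u', rfl⟩ : p <+: u := by
    refine List.prefix_of_prefix_length_le (l₃ := y.toWord) ⟨t, h2.symm⟩ ⟨_, hyu.symm⟩ ?_
    lia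
  have hconj : x⁻¹ * y * x = mk ((invRev s ++ u') ++ a :: invRev (invRev s ++ u')) := by
    have hxu : x⁻¹ * mk (p ++ u') = mk (invRev s ++ u') := by
      rw [← mk_toWord (x := x), h1, ← mul_mk, ← mul_mk, ← mul_mk, ← inv_mk]
      group
    rw [mk_conj_letter, ← hxu, ← mk_toWord (x := y), hyu, mk_conj_letter]
    group
  have hle := norm_mk_conj_letter_le (invRev s ++ u') a
  rw [← hconj, List.length_append, invRev_length] at hle
  rw [List.length_append] at hynorm
  rcases lt_or_eq_of_le (show (x⁻¹ * y * x).norm ≤ y.norm by lia) with hlt | heq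
  · exact complexity_lt_of_norm_lt hlt
  have hword : (x⁻¹ * y * x).toWord = (invRev s ++ u') ++ a :: invRev (invRev s ++ u') := by
    have hsub : (x⁻¹ * y * x).toWord.Sublist
        ((invRev s ++ u') ++ a :: invRev (invRev s ++ u')) := by
      rw [hconj, toWord_mk]
      exact reduce.red.sublist
    refine hsub.eq_of_length ?_
    change (x⁻¹ * y * x).norm = _
    rw [heq, hynorm]
    simp [hs]
    lia
  have hlen : y.norm / 2 = p.length + u'.length := by lia
  refine complexity_lt_of_halfRank_lt heq ?_
  have e1 : (x⁻¹ * y * x).toWord.take (y.norm / 2) = invRev s ++ u' := by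
    rw [hword, List.take_left' (by simp [hs, hlen])]
  have e2 : (x⁻¹ * y * x)⁻¹.toWord.take (y.norm / 2) = invRev s ++ u' := by
    rw [toWord_inv, hword, invRev_append, invRev_cons, invRev_invRev, List.append_assoc,
      List.take_left' (by simp [hs, hlen])]
  have e3 : y.toWord.take (y.norm / 2) = p ++ u' := by
    rw [hyu, List.take_left' (by simp [hlen])]
  have e4 : y⁻¹.toWord.take (y.norm / 2) = p ++ u' := by
    rw [toWord_inv, hyu, invRev_append, invRev_cons, invRev_invRev, List.append_assoc,
      List.take_left' (by simp [hlen])]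
  simp only [halfRank, norm_inv_eq, heq, e1, e2, e3, e4]
  exact add_lt_add (wordRank_append_lt h5 _) (wordRank_append_lt h5 _)

theorem exists_complexity_lt_of_norm_lt {φ : FreeGroup α →* FreeGroup α} {Y : Set α}
    (hY : ∀ a : α × Bool, a.1 ∈ Y → ∃ u, (φ (mk [a])).toWord = u ++ a :: invRev u)
    {a b : α × Bool} (hab : a.1 ≠ b.1)
    (hlt : (φ (mk [a])).norm < 2 * gromovProduct (φ (mk [a])) (φ (mk [b]))) :
    ∃ a b : α × Bool, a.1 ≠ b.1 ∧
      (b.1 ∉ Y → complexity ((φ (mk [a]))⁻¹ * φ (mk [b])) < complexity (φ (mk [b]))) ∧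
      (b.1 ∈ Y →
        complexity ((φ (mk [a]))⁻¹ * φ (mk [b]) * φ (mk [a])) < complexity (φ (mk [b]))) := by
  by_cases hb : b.1 ∈ Y
  swap
  · exact ⟨a, b, hab, fun _ => complexity_inv_mul_lt hlt, fun h => absurd h hb⟩
  obtain ⟨u, hu⟩ := hY b hb
  by_cases hau : (φ (mk [a])).norm < 2 * u.length
  · exact ⟨a, b, hab, fun h => absurd hb h, fun _ => complexity_conj_lt hu hlt hau⟩
  have hbn : (φ (mk [b])).norm = 2 * u.length + 1 := by simp [norm, hu]; lia
  have hlt' : (φ (mk [b])).norm < 2 * gromovProduct (φ (mk [b])) (φ (mk [a])) := by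
    rw [gromovProduct_comm]
    lia
  by_cases ha : a.1 ∈ Y
  swap
  · exact ⟨b, a, hab.symm, fun _ => complexity_inv_mul_lt hlt', fun h => absurd h ha⟩
  obtain ⟨v, hv⟩ := hY a ha
  by_cases hbv : (φ (mk [b])).norm < 2 * v.length
  · exact ⟨b, a, hab.symm, fun h => absurd ha h, fun _ => complexity_conj_lt hv hlt' hbv⟩
  have han : (φ (mk [a])).norm = 2 * v.length + 1 := by simp [norm, hv]; lia
  have huv : u.length = v.length := by lia
  obtain ⟨-, -, htake⟩ := List.le_commonPrefixLength_iff.1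
    (show u.length + 1 ≤ gromovProduct (φ (mk [a])) (φ (mk [b])) by lia)
  rw [hu, hv, List.take_append, List.take_append, List.take_of_length_le (l := v) (by lia),
    List.take_of_length_le (l := u) (by lia), ← huv, Nat.add_sub_cancel_left, List.take_succ_cons,
    List.take_succ_cons, List.take_zero, List.take_zero] at htake
  have := (List.append_inj htake huv.symm).2
  exact absurd (congrArg Prod.fst (List.singleton_inj.1 this)) hab

/-- An automorphism that is not Nielsen reduced can be simplified by a transvection or, at a letter
sent to a conjugate of itself, by a partial conjugation. -/
theorem exists_complexity_lt_of_not_isNielsenReduced {φ : FreeGroup α →* FreeGroup α}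
    (hinj : Function.Injective φ) {Y : Set α}
    (hY : ∀ a : α × Bool, a.1 ∈ Y → ∃ u, (φ (mk [a])).toWord = u ++ a :: invRev u)
    (hφ : ¬ IsNielsenReduced φ) :
    ∃ a b : α × Bool, a.1 ≠ b.1 ∧
      (b.1 ∉ Y → complexity ((φ (mk [a]))⁻¹ * φ (mk [b])) < complexity (φ (mk [b]))) ∧
      (b.1 ∈ Y →
        complexity ((φ (mk [a]))⁻¹ * φ (mk [b]) * φ (mk [a])) < complexity (φ (mk [b]))) := by
  by_contra hno
  have hle : ∀ a b : α × Bool, a.1 ≠ b.1 →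
      2 * gromovProduct (φ (mk [a])) (φ (mk [b])) ≤ (φ (mk [a])).norm := fun a b hab => by
    by_contra! hlt
    exact hno (exists_complexity_lt_of_norm_lt hY hab hlt)
  have hinv : ∀ a : α × Bool,
      2 * gromovProduct (φ (mk [a])) (φ (mk [a]))⁻¹ < (φ (mk [a])).norm := fun a => by
    refine two_mul_gromovProduct_inv_lt fun h => ?_
    rw [← _root_.map_one φ, hinj.eq_iff] at h
    rcases mk_singleton_eq_or a.1 a rfl with h' | h' <;> simp [h'] at h
  have hle' : ∀ a b : α × Bool, b ≠ a →
      2 * gromovProduct (φ (mk [a])) (φ (mk [b])) ≤ (φ (mk [a])).norm ∧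
      (a.1 = b.1 → 2 * gromovProduct (φ (mk [a])) (φ (mk [b])) < (φ (mk [a])).norm) := by
    intro a b hba
    by_cases hab : a.1 = b.1
    · have : b = (a.1, !a.2) := by
        ext
        · exact hab.symm
        · have : b.2 ≠ a.2 := fun h => hba (Prod.ext hab.symm h)
          cases h : b.2 <;> cases h' : a.2 <;> simp_all
      rw [this, mk_singleton_not, _root_.map_inv]
      exact ⟨(hinv a).le, fun _ => hinv a⟩
    · exact ⟨hle a b hab, fun h => absurd h hab⟩
  simp only [IsNielsenReduced, not_forall, not_lt] at hφ
  obtain ⟨a, b, c, hba, hca, hsum⟩ := hφ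
  have key : ∀ a b : α × Bool, a.1 ≠ b.1 →
      (φ (mk [a])).norm = 2 * gromovProduct (φ (mk [a])) (φ (mk [b])) →
      ¬ wordRank ((φ (mk [a]))⁻¹.toWord.take (gromovProduct (φ (mk [a])) (φ (mk [b])))) <
        wordRank ((φ (mk [a])).toWord.take (gromovProduct (φ (mk [a])) (φ (mk [b])))) := by
    intro a b hab heq hlt
    have hb := hle b a hab.symm
    rw [gromovProduct_comm] at hb
    refine hno ⟨a, b, hab, fun _ => complexity_inv_mul_lt_of_wordRank_lt heq hb hlt, fun hbY => ?_⟩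
    obtain ⟨u, hu⟩ := hY b hbY
    exact complexity_conj_lt_of_wordRank_lt hu heq hb hlt
  have hb := hle' a b hba
  have hc := hle' _ c hca
  rw [mk_singleton_not, _root_.map_inv, norm_inv_eq] at hc
  rw [gromovProduct_comm (φ (mk [b])), gromovProduct_comm (φ (mk [c]))] at hsum
  have hab : a.1 ≠ b.1 := fun h => by have := hb.2 h; lia
  have hac : a.1 ≠ c.1 := fun h => by have := hc.2 h; lia
  have h1 := key a b hab (by lia)
  have h2 := key (a.1, !a.2) c hac
  rw [mk_singleton_not, _root_.map_inv, norm_inv_eq, inv_inv] at h2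
  have h2 := h2 (by lia)
  rw [show gromovProduct (φ (mk [a]))⁻¹ (φ (mk [c])) =
    gromovProduct (φ (mk [a])) (φ (mk [b])) by lia] at h2
  have hrank := wordRank_inj (by simp [invRev_length]) (le_antisymm (not_lt.1 h1) (not_lt.1 h2))
  have h3 : gromovProduct (φ (mk [a])) (φ (mk [b])) ≤
      gromovProduct (φ (mk [a])) (φ (mk [a]))⁻¹ := by
    have := gromovProduct_le_left (φ (mk [a])) (φ (mk [b]))
    refine List.le_commonPrefixLength_iff.2 ⟨this, ?_, hrank⟩
    rwa [toWord_inv, invRev_length]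
  have := hinv a
  lia

/-- A subgroup of automorphisms fixing the conjugacy classes of the letters in `Y` contains all such
automorphisms if it contains the transvections of the letters outside `Y`, the partial conjugations
of the letters in `Y`, and the signed permutations fixing `Y`. -/
theorem mem_of_forall_isConj {Y : Set α} {H : Subgroup (MulAut (FreeGroup α))}
    (hH : ∀ ψ ∈ H, ∀ i ∈ Y, IsConj (of i) (ψ (of i)))
    (hmul : ∀ a b : α × Bool, a.1 ≠ b.1 → b.1 ∉ Y →
      ∃ ψ ∈ H, ψ (mk [b]) = (mk [a])⁻¹ * mk [b] ∧ ∀ k ≠ b.1, ψ (of k) = of k)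
    (hconj : ∀ a b : α × Bool, a.1 ≠ b.1 → b.1 ∈ Y →
      ∃ ψ ∈ H, ψ (mk [b]) = (mk [a])⁻¹ * mk [b] * mk [a] ∧ ∀ k ≠ b.1, ψ (of k) = of k)
    (hperm : ∀ (φ : MulAut (FreeGroup α)) (σ : Equiv.Perm α) (ε : α → Bool),
      (∀ i, φ (of i) = mk [(σ i, ε i)]) → (∀ i ∈ Y, φ (of i) = of i) → φ ∈ H)
    (φ : MulAut (FreeGroup α)) (hφ : ∀ i ∈ Y, IsConj (of i) (φ (of i))) : φ ∈ H := by
  induction hc : ∑ i, complexity (φ (of i)) using WellFoundedLT.induction generalizing φ with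
  | ind c ih =>
  subst hc
  have hword : ∀ a : α × Bool, a.1 ∈ Y → ∃ u, (φ (mk [a])).toWord = u ++ a :: invRev u :=
    fun a ha => exists_toWord_of_isConj (φ := φ.toMonoidHom) (hφ _ ha)
  by_cases hred : IsNielsenReduced φ.toMonoidHom
  · obtain ⟨σ, ε, hσ⟩ := hred.exists_perm φ.surjective
    refine hperm φ σ ε hσ fun i hi => ?_
    obtain ⟨u, hu⟩ := hword (i, true) hi
    have hlen := congrArg List.length ((congrArg toWord (hσ i)).symm.trans hu)
    rw [toWord_mk, (isReduced_singleton _).reduce_eq] at hlen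
    have : u = [] := by
      rw [← List.length_eq_zero_iff]
      simp at hlen
      lia
    subst this
    rw [← toWord_inj, toWord_of]
    simpa [of] using hu
  have hstep : ∀ ψ ∈ H, ∀ b : α × Bool,
      complexity (φ (ψ (mk [b]))) < complexity (φ (mk [b])) →
      (∀ k ≠ b.1, ψ (of k) = of k) → φ ∈ H := by
    intro ψ hψ b hlt hfix
    have hsum : ∑ i, complexity ((φ * ψ) (of i)) < ∑ i, complexity (φ (of i)) := by
      have hb : complexity (φ (ψ (of b.1))) < complexity (φ (of b.1)) := by
        rcases mk_singleton_eq_or b.1 b rfl with h | h <;> rw [h] at hlt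
        · exact hlt
        · simpa only [_root_.map_inv, complexity_inv] using hlt
      refine Finset.sum_lt_sum (fun i _ => ?_) ⟨b.1, Finset.mem_univ _, hb⟩
      by_cases hi : i = b.1
      · rw [hi]
        exact hb.le
      · rw [MulAut.mul_apply, hfix i hi]
    have := ih _ hsum (φ * ψ) (fun i hi => (hφ i hi).trans
      (MonoidHom.map_isConj φ.toMonoidHom (hH ψ hψ i hi))) rfl
    simpa using H.mul_mem this (H.inv_mem hψ)
  obtain ⟨a, b, hab, h1, h2⟩ :=
    exists_complexity_lt_of_not_isNielsenReduced (φ := φ.toMonoidHom) φ.injective hword hred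
  by_cases hb : b.1 ∈ Y
  · obtain ⟨ψ, hψ, hψb, hfix⟩ := hconj a b hab hb
    exact hstep ψ hψ b (by
      simp only [hψb, _root_.map_mul, _root_.map_inv]
      exact h2 hb)
      hfix
  · obtain ⟨ψ, hψ, hψb, hfix⟩ := hmul a b hab hb
    exact hstep ψ hψ b (by
      simp only [hψb, _root_.map_mul, _root_.map_inv]
      exact h1 hb)
      hfix

theorem mem_of_signed_perm {Y : Set α} {H : Subgroup (MulAut (FreeGroup α))}
    (hswap : ∀ (ψ : MulAut (FreeGroup α)) (i j : α), i ∉ Y → j ∉ Y → i ≠ j →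
      ψ (of i) = of j → ψ (of j) = of i → (∀ k, k ≠ i → k ≠ j → ψ (of k) = of k) → ψ ∈ H)
    (hinv : ∀ (ψ : MulAut (FreeGroup α)) (i : α), i ∉ Y →
      ψ (of i) = (of i)⁻¹ → (∀ k ≠ i, ψ (of k) = of k) → ψ ∈ H)
    (φ : MulAut (FreeGroup α)) (σ : Equiv.Perm α) (ε : α → Bool)
    (hφ : ∀ i, φ (of i) = mk [(σ i, ε i)]) (hY : ∀ i ∈ Y, φ (of i) = of i) : φ ∈ H := by
  classical
  have hσε : ∀ i ∈ Y, σ i = i ∧ ε i = true := fun i hi => by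
    have := congrArg toWord ((hφ i).symm.trans (hY i hi))
    rwa [toWord_mk, (isReduced_singleton _).reduce_eq, toWord_of, List.singleton_inj,
      Prod.mk.injEq] at this
  have hpermAux : ∀ τ : Equiv.Perm {i // i ∉ Y},
      (freeGroupCongr (Equiv.Perm.ofSubtype τ) : MulAut (FreeGroup α)) ∈ H := by
    intro τ
    induction τ using Equiv.Perm.swap_induction_on with
    | one =>
      convert H.one_mem
      exact mulAut_ext fun i => by simp
    | swap_mul τ x y hxy ih =>
      have hmul : (freeGroupCongr (Equiv.Perm.ofSubtype (Equiv.swap x y * τ)) :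
          MulAut (FreeGroup α)) = freeGroupCongr (Equiv.swap (x : α) y) *
            freeGroupCongr (Equiv.Perm.ofSubtype τ) :=
        mulAut_ext fun i => by simp [Equiv.Perm.ofSubtype_swap_eq]
      rw [hmul]
      refine H.mul_mem (hswap _ x y x.2 y.2 (Subtype.coe_injective.ne hxy) (by simp) (by simp)
        fun k hx hy => ?_) ih
      simp [Equiv.swap_apply_of_ne_of_ne hx hy]
  have hperm : (freeGroupCongr σ : MulAut (FreeGroup α)) ∈ H := by
    have hpres : ∀ i, σ i ∉ Y ↔ i ∉ Y := fun i => by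
      refine not_congr ⟨fun h => ?_, fun h => ?_⟩
      · rwa [← σ.injective (hσε _ h).1]
      · rwa [(hσε i h).1]
    have := hpermAux (σ.subtypePerm hpres)
    rwa [Equiv.Perm.ofSubtype_subtypePerm] at this
    exact fun i hi h => hi (hσε i h).1
  have hsign : ∀ (s : Finset α), (∀ i ∈ s, i ∉ Y) → ∀ ψ : MulAut (FreeGroup α),
      (∀ i ∈ s, ψ (of i) = (of i)⁻¹) → (∀ i ∉ s, ψ (of i) = of i) → ψ ∈ H := by
    intro s
    induction s using Finset.induction_on with
    | empty =>
      intro _ ψ _ hψ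
      rw [show ψ = 1 from mulAut_ext fun i => by simpa using hψ i (by simp)]
      exact H.one_mem
    | insert a s ha ih =>
      intro hs ψ h1 h2
      obtain ⟨ι, hιa, hιk⟩ := exists_mulAut_of_eq_inv a
      have hι : ι ∈ H := hinv ι a (hs a (by simp)) hιa hιk
      have : ψ * ι ∈ H := by
        refine ih (fun i hi => hs i (by simp [hi])) _ (fun i hi => ?_) fun i hi => ?_
        · have : i ≠ a := fun h => ha (h ▸ hi)
          rw [MulAut.mul_apply, hιk i this, h1 i (by simp [hi])]
        · by_cases h : i = a
          · rw [h, MulAut.mul_apply, hιa, _root_.map_inv, h1 a (by simp), inv_inv]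
          · rw [MulAut.mul_apply, hιk i h, h2 i (by simp [hi, h])]
      simpa using H.mul_mem this (H.inv_mem hι)
  let p : MulAut (FreeGroup α) := freeGroupCongr σ
  have hp : ∀ i, p⁻¹ (of (σ i)) = of i := fun i => by
    have : p (of i) = of (σ i) := by simp [p]
    rw [← this, ← MulAut.mul_apply, inv_mul_cancel, MulAut.one_apply]
  have : p⁻¹ * φ ∈ H := by
    refine hsign (Finset.univ.filter fun i => ε i = false) ?_ _ ?_ ?_ <;> intro i hi <;>
      simp only [Finset.mem_filter, Finset.mem_univ, true_and, Bool.not_eq_false] at hi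
    · intro h
      simp [(hσε i h).2] at hi
    · rw [MulAut.mul_apply, hφ, hi, ← hp, ← _root_.map_inv]
      exact congrArg _ (mk_singleton_not (σ i, true))
    · rw [MulAut.mul_apply, hφ, hi]
      exact hp i
  have hpH : p ∈ H := hperm
  simpa only [mul_inv_cancel_left] using H.mul_mem hpH this

end FreeGroup

namespace FreeGroup

variable {m : ℕ}

/-- The subgroup generated by the automorphisms `P_{i,j}`, `I_i`, `(cᵢ^{±1}; z)` and `(yᵢ^±; z)`. -/
def conjugacyStabilizer (m : ℕ) : Subgroup (MulAut (G m)) :=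
  Subgroup.closure {φ | IsP φ ∨ IsI φ ∨ IsTransC φ ∨ IsConjY φ}

theorem isConj_of_mem_conjugacyStabilizer {φ : MulAut (G m)} (hφ : φ ∈ conjugacyStabilizer m)
    {i : Fin (m + 2)} (hi : (i : ℕ) < 2) : IsConj (of i) (φ (of i)) := by
  induction hφ using Subgroup.closure_induction with
  | one => exact IsConj.refl _
  | mul φ ψ _ _ h1 h2 => exact h1.trans (MonoidHom.map_isConj φ.toMonoidHom h2)
  | inv φ _ h =>
    have := (MonoidHom.map_isConj (φ⁻¹).toMonoidHom h).symm
    change IsConj (φ⁻¹ (φ (of i))) _ at this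
    rwa [← MulAut.mul_apply, inv_mul_cancel] at this
  | mem φ hφ =>
    rcases hφ with ⟨j, k, hj, hk, -, -, -, h⟩ | ⟨j, hj, -, h⟩ | ⟨j, hj, z, -, -, h⟩ |
      ⟨j, hj, z, -, hz, h⟩
    · rw [h i (by rintro rfl; lia) (by rintro rfl; lia)]
    · rw [h i (by rintro rfl; lia)]
    · rw [h i (by rintro rfl; lia)]
    · by_cases hij : i = j
      · rw [hij, hz]
        exact isConj_iff.2 ⟨z⁻¹, by group⟩
      · rw [h i hij]

theorem of_mem_ZSet {i j : Fin (m + 2)} (hij : j ≠ i) : of j ∈ ZSet m i := by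
  by_cases h : 2 ≤ (j : ℕ)
  · exact Or.inr ⟨j, h, hij, rfl⟩
  · rcases (show (j : ℕ) = 0 ∨ (j : ℕ) = 1 by lia) with h | h
    · exact Or.inl (Or.inl (congrArg of (Fin.ext h)))
    · exact Or.inl (Or.inr (congrArg of (Fin.ext h)))

theorem of_mem_closure_compl {α : Type*} {i j : α} (hij : j ≠ i) :
    of j ∈ Subgroup.closure (of '' {i}ᶜ) :=
  Subgroup.subset_closure ⟨j, hij, rfl⟩

theorem exists_transvection_mem (a b : Fin (m + 2) × Bool) (hab : a.1 ≠ b.1)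
    (hb : 2 ≤ (b.1 : ℕ)) :
    ∃ ψ ∈ conjugacyStabilizer m,
      ψ (mk [b]) = (mk [a])⁻¹ * mk [b] ∧ ∀ k ≠ b.1, ψ (of k) = of k := by
  obtain ⟨j, s⟩ := a
  obtain ⟨i, t⟩ := b
  have hz := of_mem_closure_compl hab
  have hj (s : Bool) : mk [(j, s)] = if s then of j else (of j)⁻¹ := by
    cases s
    · exact mk_singleton_not (j, true)
    · rfl
  have hi (s : Bool) : mk [(i, s)] = if s then of i else (of i)⁻¹ := by
    cases s
    · exact mk_singleton_not (i, true)
    · rfl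
  obtain ⟨ψ, ⟨h1, h2⟩, h3, h4⟩ := exists_mulAut_of_eq_mul_mul i (inv_mem hz) (one_mem _)
  obtain ⟨χ, ⟨h5, h6⟩, h7, h8⟩ := exists_mulAut_of_eq_mul_mul i (one_mem _) hz
  rw [mul_one] at h1
  rw [one_mul] at h5
  have hψ : ψ ∈ conjugacyStabilizer m := Subgroup.subset_closure
    (Or.inr (Or.inr (Or.inl ⟨i, hb, _, of_mem_ZSet hab, Or.inr h1, h2⟩)))
  have hχ : χ ∈ conjugacyStabilizer m := Subgroup.subset_closure
    (Or.inr (Or.inr (Or.inl ⟨i, hb, _, of_mem_ZSet hab, Or.inl h5, h6⟩)))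
  rw [hj, hi]
  cases s <;> cases t
  · exact ⟨_, inv_mem hχ, by simp only [Bool.false_eq_true, if_false]; rw [_root_.map_inv, h7]; group, h8⟩
  · exact ⟨_, inv_mem hψ, by simp [h3, -MulAut.inv_apply], h4⟩
  · exact ⟨χ, hχ, by simp [h5], h6⟩
  · exact ⟨ψ, hψ, by simp [h1], h2⟩

theorem exists_partial_conj_mem (a b : Fin (m + 2) × Bool) (hab : a.1 ≠ b.1)
    (hb : (b.1 : ℕ) < 2) :
    ∃ ψ ∈ conjugacyStabilizer m,
      ψ (mk [b]) = (mk [a])⁻¹ * mk [b] * mk [a] ∧ ∀ k ≠ b.1, ψ (of k) = of k := by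
  have hz := of_mem_closure_compl hab
  obtain ⟨ψ, ⟨h1, h2⟩, h3, h4⟩ := exists_mulAut_of_eq_mul_mul b.1 (inv_mem hz) hz
  have hψ : ψ ∈ conjugacyStabilizer m := Subgroup.subset_closure
    (Or.inr (Or.inr (Or.inr ⟨b.1, hb, _, ⟨a.1, hab, rfl⟩, h1, h2⟩)))
  rcases mk_singleton_eq_or a.1 a rfl with ha | ha <;>
    rcases mk_singleton_eq_or b.1 b rfl with hb | hb <;> rw [ha, hb]
  · exact ⟨ψ, hψ, h1, h2⟩
  · exact ⟨ψ, hψ, by rw [_root_.map_inv, h1]; group, h2⟩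
  · exact ⟨_, inv_mem hψ, h3, h4⟩
  · exact ⟨_, inv_mem hψ, by rw [_root_.map_inv, h3]; group, h4⟩

end FreeGroup

/-- the subgroup `Aut(G; [y₁], [y₂])` of automorphisms preserving the
conjugacy classes of `y₁` and of `y₂` is generated by the automorphisms `P_{i,j}`,
`I_i`, `(cᵢ^{±1}; z)` for `z ∈ {y₁, y₂} ∪ {c_j : j ≠ i}`, and `(yᵢ^±; z)` for
`i ∈ {1, 2}` and `z ∈ {y₁, y₂, c₁, …, c_m} \ {yᵢ}`. -/
theorem conjugacy_stabilizer_generators (m : ℕ) :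
    ∃ S : Subgroup (MulAut (G m)),
      (S : Set (MulAut (G m))) =
        {φ : MulAut (G m) |
          IsConj (FreeGroup.of 0) (φ (FreeGroup.of 0)) ∧
          IsConj (FreeGroup.of 1) (φ (FreeGroup.of 1))} ∧
      S = Subgroup.closure {φ | IsP φ ∨ IsI φ ∨ IsTransC φ ∨ IsConjY φ} := by
  refine ⟨Subgroup.closure {φ | IsP φ ∨ IsI φ ∨ IsTransC φ ∨ IsConjY φ}, ?_, rfl⟩
  ext φ
  refine ⟨fun hφ => ⟨FreeGroup.isConj_of_mem_conjugacyStabilizer hφ (by simp),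
    FreeGroup.isConj_of_mem_conjugacyStabilizer hφ (by simp)⟩, fun hφ => ?_⟩
  refine FreeGroup.mem_of_forall_isConj (H := FreeGroup.conjugacyStabilizer m)
    (Y := {i : Fin (m + 2) | (i : ℕ) < 2})
    (fun ψ hψ i hi => FreeGroup.isConj_of_mem_conjugacyStabilizer hψ hi)
    (fun a b hab hb => FreeGroup.exists_transvection_mem a b hab (not_lt.1 hb))
    FreeGroup.exists_partial_conj_mem
    (FreeGroup.mem_of_signed_perm
      (fun ψ i j hi hj hij h1 h2 h3 => Subgroup.subset_closure
        (Or.inl ⟨i, j, not_lt.1 hi, not_lt.1 hj, hij, h1, h2, h3⟩))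
      fun ψ i hi h1 h2 => Subgroup.subset_closure (Or.inr (Or.inl ⟨i, not_lt.1 hi, h1, h2⟩)))
    φ fun i hi => ?_
  rcases (show (i : ℕ) = 0 ∨ (i : ℕ) = 1 by have : (i : ℕ) < 2 := hi; lia) with h | h
  · obtain rfl : i = 0 := Fin.ext h
    exact hφ.1
  · obtain rfl : i = 1 := Fin.ext h
    exact hφ.2
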